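/- arXiv:1109.5777 — 13 statements merged into one kernel-verified Lean document; each statement's English description precedes it below -/
import Mathlib

section
/- Let n, c₁, c₂ be real constants with n ≠ 0, let f : ℝ → ℝ be continuously differentiable, and let x : ℝ → ℝ be twice differentiable and strictly positive on an open interval I. Then x satisfies on I the nonlinear second-order equation x'' + (n−1)·(x')²/x + (c₁ + 2·f(x) + (1/n)·x·f'(x))·x' + (x/n)·(f(x)² + c₁·f(x) + c₂) = 0 if and only if the function X(t) = n·x'(t)/x(t) + f(x(t)) satisfies the Riccati equation X' + X² + c₁·X + c₂ = 0 on I. -/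
/-- The nonlinear second-order ODE
`x'' + (n−1)(x')²/x + (c₁ + 2f(x) + (1/n)x f'(x))x' + (x/n)(f(x)² + c₁ f(x) + c₂) = 0`
holds on an open interval (on which `x` is twice differentiable and positive) iff
`X(t) = n x'(t)/x(t) + f(x(t))` satisfies the Riccati equation `X' + X² + c₁X + c₂ = 0`. -/
theorem stmt_0 (n c₁ c₂ : ℝ) (hn : n ≠ 0) (f : ℝ → ℝ) (hf : ContDiff ℝ 1 f)
    (a b : ℝ) (x : ℝ → ℝ)
    (hx : ∀ t ∈ Set.Ioo a b, DifferentiableAt ℝ x t)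
    (hx' : ∀ t ∈ Set.Ioo a b, DifferentiableAt ℝ (deriv x) t)
    (hpos : ∀ t ∈ Set.Ioo a b, 0 < x t) :
    (∀ t ∈ Set.Ioo a b,
        deriv (deriv x) t + (n - 1) * (deriv x t) ^ 2 / x t
          + (c₁ + 2 * f (x t) + (1 / n) * x t * deriv f (x t)) * deriv x t
          + (x t / n) * ((f (x t)) ^ 2 + c₁ * f (x t) + c₂) = 0) ↔
    (∀ t ∈ Set.Ioo a b,
        deriv (fun s => n * deriv x s / x s + f (x s)) t
          + (n * deriv x t / x t + f (x t)) ^ 2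
          + c₁ * (n * deriv x t / x t + f (x t)) + c₂ = 0) := by
  refine forall₂_congr fun t ht => ?_
  have hxt : x t ≠ 0 := (hpos t ht).ne'
  have hfx : HasDerivAt f (deriv f (x t)) (x t) :=
    (hf.differentiable one_ne_zero (x t)).hasDerivAt
  have hX : HasDerivAt (fun s => n * deriv x s / x s + f (x s))
      ((n * deriv (deriv x) t * x t - n * deriv x t * deriv x t) / x t ^ 2
        + deriv f (x t) * deriv x t) t :=
    (((hx' t ht).hasDerivAt.const_mul n).div (hx t ht).hasDerivAt hxt).add
      (hfx.comp t (hx t ht).hasDerivAt)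
  rw [hX.deriv, iff_comm, ← mul_eq_zero_iff_left (div_ne_zero hxt hn)]
  refine Eq.congr ?_ rfl
  field_simp
  ring
end

section
/- Let n, c₁, c₂ be real constants with n ≠ 0, let f : ℝ → ℝ be continuously differentiable, let x : ℝ → ℝ be twice differentiable and strictly positive on an open interval I, and let F : I → ℝ be differentiable with F'(t) = f(x(t)) for all t ∈ I. Define U(t) = x(t)^n · exp(F(t)). Then x satisfies on I the equation x'' + (n−1)·(x')²/x + (c₁ + 2·f(x) + (1/n)·x·f'(x))·x' + (x/n)·(f(x)² + c₁·f(x) + c₂) = 0 if and only if U satisfies the linear equation U'' + c₁·U' + c₂·U = 0 on I. -/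
/-- Logarithmic differentiation of `xⁿ e^F`. -/
theorem hasDerivAt_rpow_mul_exp {x F : ℝ → ℝ} {x' F' t : ℝ} (n : ℝ) (hpos : 0 < x t)
    (hx : HasDerivAt x x' t) (hF : HasDerivAt F F' t) :
    HasDerivAt (fun s => x s ^ n * Real.exp (F s))
      (x t ^ n * Real.exp (F t) * (n * x' / x t + F')) t := by
  refine ((hx.rpow_const (p := n) (Or.inl hpos.ne')).mul hF.exp).congr_deriv ?_
  rw [Real.rpow_sub_one hpos.ne']
  field_simp

/-- With `U(t) = x(t)^n · exp(F(t))` where `F' = f∘x` on the interval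
(the nonlocal transformation `U = xⁿ e^{∫f(x)dt}`), the nonlinear equation
`x'' + (n−1)(x')²/x + (c₁ + 2f(x) + (1/n)x f'(x))x' + (x/n)(f(x)² + c₁f(x) + c₂) = 0`
holds iff the linear equation `U'' + c₁U' + c₂U = 0` holds. -/
theorem stmt_1 (n c₁ c₂ : ℝ) (hn : n ≠ 0) (f : ℝ → ℝ) (hf : ContDiff ℝ 1 f)
    (a b : ℝ) (x F : ℝ → ℝ)
    (hx : ∀ t ∈ Set.Ioo a b, DifferentiableAt ℝ x t)
    (hx' : ∀ t ∈ Set.Ioo a b, DifferentiableAt ℝ (deriv x) t)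
    (hpos : ∀ t ∈ Set.Ioo a b, 0 < x t)
    (hF : ∀ t ∈ Set.Ioo a b, HasDerivAt F (f (x t)) t)
    (U : ℝ → ℝ) (hU : U = fun t => x t ^ n * Real.exp (F t)) :
    (∀ t ∈ Set.Ioo a b,
        deriv (deriv x) t + (n - 1) * (deriv x t) ^ 2 / x t
          + (c₁ + 2 * f (x t) + (1 / n) * x t * deriv f (x t)) * deriv x t
          + (x t / n) * ((f (x t)) ^ 2 + c₁ * f (x t) + c₂) = 0) ↔
    (∀ t ∈ Set.Ioo a b,
        deriv (deriv U) t + c₁ * deriv U t + c₂ * U t = 0) := by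
  have hU1 : ∀ t ∈ Set.Ioo a b, HasDerivAt U (U t * (n * deriv x t / x t + f (x t))) t := by
    intro t ht
    subst hU
    exact hasDerivAt_rpow_mul_exp n (hpos t ht) (hx t ht).hasDerivAt (hF t ht)
  have hU2 : ∀ t ∈ Set.Ioo a b, deriv (deriv U) t =
      U t * (n * deriv x t / x t + f (x t)) * (n * deriv x t / x t + f (x t))
        + U t * ((n * deriv (deriv x) t * x t - n * deriv x t * deriv x t) / x t ^ 2
          + deriv f (x t) * deriv x t) := by
    intro t ht
    have hfx : HasDerivAt (fun s => f (x s)) (deriv f (x t) * deriv x t) t :=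
      ((hf.differentiable one_ne_zero) (x t)).hasDerivAt.comp t (hx t ht).hasDerivAt
    have hg := (((hx' t ht).hasDerivAt.const_mul n).div (hx t ht).hasDerivAt
      (hpos t ht).ne').add hfx
    have heq : deriv U =ᶠ[nhds t] fun s => U s * (n * deriv x s / x s + f (x s)) :=
      Filter.eventually_of_mem (isOpen_Ioo.mem_nhds ht) fun s hs => (hU1 s hs).deriv
    rw [heq.deriv_eq]
    exact ((hU1 t ht).mul hg).deriv
  refine forall₂_congr fun t ht => ?_
  have hxt : x t ≠ 0 := (hpos t ht).ne'
  have hUt : U t ≠ 0 := by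
    subst hU
    exact (mul_pos (Real.rpow_pos_of_pos (hpos t ht) n) (Real.exp_pos _)).ne'
  have key : deriv (deriv U) t + c₁ * deriv U t + c₂ * U t = U t * n / x t *
      (deriv (deriv x) t + (n - 1) * (deriv x t) ^ 2 / x t
          + (c₁ + 2 * f (x t) + (1 / n) * x t * deriv f (x t)) * deriv x t
          + (x t / n) * ((f (x t)) ^ 2 + c₁ * f (x t) + c₂)) := by
    rw [hU2 t ht, (hU1 t ht).deriv]
    field_simp
    ring
  rw [key, mul_eq_zero, or_iff_right (div_ne_zero (mul_ne_zero hUt hn) hxt)]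
end

section
/- Let n be a real constant with n ≠ 0, let f : ℝ → ℝ be continuously differentiable, and let x : ℝ → ℝ be twice differentiable and strictly positive on an open interval I satisfying x'' + (n−1)·(x')²/x + 2·x'·f(x) + (1/n)·x·x'·f'(x) + (x/n)·f(x)² = 0 on I. Then the function z(t) = x'(t)/x(t) + f(x(t))/n satisfies the Riccati equation z' = −n·z² on I. -/
/-- If `x` (twice differentiable, positive on an open interval) satisfies
`x'' + (n−1)(x')²/x + 2x'f(x) + (1/n)x x' f'(x) + (x/n)f(x)² = 0`, then
`z(t) = x'(t)/x(t) + f(x(t))/n` satisfies the Riccati equation `z' = −n z²`. -/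
theorem stmt_2 (n : ℝ) (hn : n ≠ 0) (f : ℝ → ℝ) (hf : ContDiff ℝ 1 f)
    (a b : ℝ) (x : ℝ → ℝ)
    (hx : ∀ t ∈ Set.Ioo a b, DifferentiableAt ℝ x t)
    (hx' : ∀ t ∈ Set.Ioo a b, DifferentiableAt ℝ (deriv x) t)
    (hpos : ∀ t ∈ Set.Ioo a b, 0 < x t)
    (heq : ∀ t ∈ Set.Ioo a b,
        deriv (deriv x) t + (n - 1) * (deriv x t) ^ 2 / x t
          + 2 * deriv x t * f (x t) + (1 / n) * x t * deriv x t * deriv f (x t)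
          + (x t / n) * (f (x t)) ^ 2 = 0) :
    ∀ t ∈ Set.Ioo a b,
      deriv (fun s => deriv x s / x s + f (x s) / n) t
        = -n * (deriv x t / x t + f (x t) / n) ^ 2 := by
  intro t ht
  have hx0 : x t ≠ 0 := (hpos t ht).ne'
  have hfx : HasDerivAt (fun s => f (x s)) (deriv f (x t) * deriv x t) t :=
    ((hf.differentiable one_ne_zero) (x t)).hasDerivAt.comp t (hx t ht).hasDerivAt
  have hz := ((hx' t ht).hasDerivAt.fun_div (hx t ht).hasDerivAt hx0).fun_add (hfx.div_const n)
  rw [hz.deriv]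
  have hsolve : deriv (deriv x) t = -((n - 1) * (deriv x t) ^ 2 / x t
      + 2 * deriv x t * f (x t) + (1 / n) * x t * deriv x t * deriv f (x t)
      + (x t / n) * (f (x t)) ^ 2) := by
    linarith [heq t ht]
  rw [hsolve]
  field_simp
  ring
end

section
/- Let k, m, I₁, I₂ be real constants with m ≠ 0 and m ≠ −1, and let J be an open interval on which I₁ + t > 0 and Q(t) := I₂ + (k·m/(m+1))·(I₁+t)^{m+1} > 0. Then the function x(t) = (I₁ + t) · Q(t)^{−1/m} is strictly positive on J and satisfies the generalized Emden equation x'' + (m+2)·k·x^m·x' + k²·x^{2m+1} = 0 on J. -/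
/-- The function `x(t) = (c + t) (d + (km/(m+1)) (c + t)^{m+1})^{-1/m}` solves the Bernoulli
equation `x' = x / (c + t) - k x^{m+1}`. -/
theorem hasDerivAt_bernoulli_solution {k m c d t : ℝ} (hm : m ≠ 0) (hm' : m ≠ -1)
    (hs : 0 < c + t) (hQ : 0 < d + k * m / (m + 1) * (c + t) ^ (m + 1)) :
    HasDerivAt (fun r => (c + r) * (d + k * m / (m + 1) * (c + r) ^ (m + 1)) ^ (-1 / m))
      ((c + t) * (d + k * m / (m + 1) * (c + t) ^ (m + 1)) ^ (-1 / m) / (c + t)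
        - k * ((c + t) * (d + k * m / (m + 1) * (c + t) ^ (m + 1)) ^ (-1 / m)) ^ (m + 1)) t := by
  have hm1 : m + 1 ≠ 0 := fun h => hm' (by linarith)
  have hlin : HasDerivAt (fun r => c + r) 1 t := (hasDerivAt_id t).const_add c
  have hQ' : HasDerivAt (fun r => d + k * m / (m + 1) * (c + r) ^ (m + 1))
      (k * m * (c + t) ^ m) t := by
    have h := ((hlin.rpow_const (p := m + 1) (Or.inl hs.ne')).const_mul
      (k * m / (m + 1))).const_add d
    refine h.congr_deriv ?_
    rw [add_sub_cancel_right]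
    field_simp
  have h := hlin.mul (hQ'.rpow_const (p := -1 / m) (Or.inl hQ.ne'))
  refine h.congr_deriv ?_
  generalize d + k * m / (m + 1) * (c + t) ^ (m + 1) = q at hQ
  have hexp : -1 / m * (m + 1) = -1 / m - 1 := by field_simp; ring
  rw [Real.mul_rpow hs.le (Real.rpow_nonneg hQ.le _), ← Real.rpow_mul hQ.le, hexp,
    Real.rpow_add_one hs.ne']
  field_simp
  ring

/-- Positive solutions of the Bernoulli equation `x' = x / (c + t) - k x^{m+1}` solve the
generalized Emden equation. -/
theorem emden_of_bernoulli {k m c : ℝ} {U : Set ℝ} {x : ℝ → ℝ} (hU : IsOpen U)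
    (hs : ∀ t ∈ U, 0 < c + t) (hx : ∀ t ∈ U, 0 < x t)
    (hx' : ∀ t ∈ U, HasDerivAt x (x t / (c + t) - k * x t ^ (m + 1)) t) {t : ℝ} (ht : t ∈ U) :
    deriv (deriv x) t + (m + 2) * k * x t ^ m * deriv x t + k ^ 2 * x t ^ (2 * m + 1) = 0 := by
  have hderiv : deriv x =ᶠ[nhds t] fun r => x r / (c + r) - k * x r ^ (m + 1) := by
    filter_upwards [hU.mem_nhds ht] with r hr using (hx' r hr).deriv
  have hst := (hs t ht).ne'
  have hxt := (hx t ht).ne'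
  have hlin : HasDerivAt (fun r => c + r) 1 t := (hasDerivAt_id t).const_add c
  have h := ((hx' t ht).div hlin hst).sub
    (((hx' t ht).rpow_const (p := m + 1) (Or.inl hxt)).const_mul k)
  have hsecond := hderiv.deriv_eq.trans h.deriv
  have hpow : x t ^ (2 * m + 1) = x t ^ m * x t ^ m * x t := by
    rw [Real.rpow_add_one hxt, two_mul, Real.rpow_add (hx t ht)]
  rw [hsecond, hderiv.eq_of_nhds, hpow, add_sub_cancel_right, Real.rpow_add_one hxt]
  field_simp
  ring


/-- On an open interval where `I₁ + t > 0` and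
`Q(t) = I₂ + (km/(m+1))(I₁+t)^{m+1} > 0`, the function
`x(t) = (I₁+t)·Q(t)^{−1/m}` is positive and solves the generalized Emden equation
`x'' + (m+2)k xᵐ x' + k² x^{2m+1} = 0` (powers are real powers). -/
theorem stmt_3 (k m I₁ I₂ : ℝ) (hm : m ≠ 0) (hm' : m ≠ -1) (a b : ℝ)
    (Q : ℝ → ℝ) (hQ : Q = fun t => I₂ + k * m / (m + 1) * (I₁ + t) ^ (m + 1))
    (hpos1 : ∀ t ∈ Set.Ioo a b, 0 < I₁ + t)
    (hpos2 : ∀ t ∈ Set.Ioo a b, 0 < Q t)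
    (x : ℝ → ℝ) (hx : x = fun t => (I₁ + t) * Q t ^ (-1 / m)) :
    ∀ t ∈ Set.Ioo a b,
      0 < x t ∧
      deriv (deriv x) t + (m + 2) * k * x t ^ m * deriv x t
        + k ^ 2 * x t ^ (2 * m + 1) = 0 := by
  subst hx hQ
  set x : ℝ → ℝ := fun t =>
    (I₁ + t) * (I₂ + k * m / (m + 1) * (I₁ + t) ^ (m + 1)) ^ (-1 / m)
  have hxpos : ∀ t ∈ Set.Ioo a b, 0 < x t := fun t ht =>
    mul_pos (hpos1 t ht) (Real.rpow_pos_of_pos (hpos2 t ht) _)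
  intro t ht
  exact ⟨hxpos t ht, emden_of_bernoulli isOpen_Ioo hpos1 hxpos
    (fun r hr => hasDerivAt_bernoulli_solution hm hm' (hpos1 r hr) (hpos2 r hr)) ht⟩
end

section
/- Let k, c₂ be real constants, let x : ℝ → ℝ be twice differentiable and strictly positive on an open interval I, and let F : I → ℝ be differentiable with F'(t) = k/x(t)² for all t ∈ I. Define U(t) = x(t)·exp(F(t)). Then x satisfies the Ermakov–Pinney equation x'' + c₂·x + k²/x³ = 0 on I if and only if U satisfies the harmonic oscillator equation U'' + c₂·U = 0 on I. -/
/-- First derivative of `x·exp(F)` when `F' = k/x²`. -/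
theorem hasDerivAt_mul_exp_of_hasDerivAt_div_sq {k t : ℝ} {x F : ℝ → ℝ}
    (hx : DifferentiableAt ℝ x t) (hne : x t ≠ 0) (hF : HasDerivAt F (k / (x t) ^ 2) t) :
    HasDerivAt (fun s => x s * Real.exp (F s))
      ((deriv x t + k / x t) * Real.exp (F t)) t := by
  refine (hx.hasDerivAt.mul hF.exp).congr_deriv ?_
  field_simp

/-- Derivative of `(x' + k/x)·exp(F)` when `F' = k/x²`: the terms in `x'` cancel. -/
theorem hasDerivAt_deriv_add_div_mul_exp {k t : ℝ} {x F : ℝ → ℝ}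
    (hx : DifferentiableAt ℝ x t) (hx' : DifferentiableAt ℝ (deriv x) t) (hne : x t ≠ 0)
    (hF : HasDerivAt F (k / (x t) ^ 2) t) :
    HasDerivAt (fun s => (deriv x s + k / x s) * Real.exp (F s))
      ((deriv (deriv x) t + k ^ 2 / (x t) ^ 3) * Real.exp (F t)) t := by
  have hdiv : HasDerivAt (fun s => k / x s) (-(k * deriv x t) / (x t) ^ 2) t :=
    ((hasDerivAt_const t k).div hx.hasDerivAt hne).congr_deriv (by ring)
  refine ((hx'.hasDerivAt.add hdiv).mul hF.exp).congr_deriv ?_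
  simp only [Pi.add_apply]
  field_simp
  ring

/-- With `U(t) = x(t)·exp(F(t))` where `F'(t) = k/x(t)²`
(the nonlocal transformation `U = x e^{∫k/x² dt}`), a positive twice differentiable `x`
satisfies the Ermakov–Pinney equation `x'' + c₂x + k²/x³ = 0` on an open interval iff
`U` satisfies the harmonic oscillator equation `U'' + c₂U = 0` there. -/
theorem stmt_5 (k c₂ : ℝ) (a b : ℝ) (x F : ℝ → ℝ)
    (hx : ∀ t ∈ Set.Ioo a b, DifferentiableAt ℝ x t)
    (hx' : ∀ t ∈ Set.Ioo a b, DifferentiableAt ℝ (deriv x) t)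
    (hpos : ∀ t ∈ Set.Ioo a b, 0 < x t)
    (hF : ∀ t ∈ Set.Ioo a b, HasDerivAt F (k / (x t) ^ 2) t)
    (U : ℝ → ℝ) (hU : U = fun t => x t * Real.exp (F t)) :
    (∀ t ∈ Set.Ioo a b,
        deriv (deriv x) t + c₂ * x t + k ^ 2 / (x t) ^ 3 = 0) ↔
    (∀ t ∈ Set.Ioo a b, deriv (deriv U) t + c₂ * U t = 0) := by
  subst hU
  refine forall₂_congr fun t ht => ?_
  have hderiv : deriv (fun s => x s * Real.exp (F s)) =ᶠ[nhds t]
      fun s => (deriv x s + k / x s) * Real.exp (F s) := by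
    filter_upwards [Ioo_mem_nhds ht.1 ht.2] with s hs
    exact (hasDerivAt_mul_exp_of_hasDerivAt_div_sq (hx s hs) (hpos s hs).ne' (hF s hs)).deriv
  rw [hderiv.deriv_eq,
    (hasDerivAt_deriv_add_div_mul_exp (hx t ht) (hx' t ht) (hpos t ht).ne' (hF t ht)).deriv]
  have hfactor : (deriv (deriv x) t + k ^ 2 / (x t) ^ 3) * Real.exp (F t)
      + c₂ * (x t * Real.exp (F t))
      = (deriv (deriv x) t + c₂ * x t + k ^ 2 / (x t) ^ 3) * Real.exp (F t) := by ring
  rw [hfactor, mul_eq_zero, or_iff_left (Real.exp_ne_zero _)]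
end

section
/- Let k, c₂ be real constants and let x : ℝ → ℝ be twice differentiable and strictly positive on an open interval I satisfying the Ermakov–Pinney equation x'' + c₂·x + k²/x³ = 0 on I. Then the function z(t) = x'(t)/x(t) + k/x(t)² satisfies the Riccati equation z' + z² + c₂ = 0 on I. -/
/-- If a positive twice differentiable `x` satisfies the Ermakov–Pinney
equation `x'' + c₂x + k²/x³ = 0` on an open interval, then `z = x'/x + k/x²`
satisfies the Riccati equation `z' + z² + c₂ = 0` there. -/
theorem stmt_6 (k c₂ : ℝ) (a b : ℝ) (x : ℝ → ℝ)
    (hx : ∀ t ∈ Set.Ioo a b, DifferentiableAt ℝ x t)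
    (hx' : ∀ t ∈ Set.Ioo a b, DifferentiableAt ℝ (deriv x) t)
    (hpos : ∀ t ∈ Set.Ioo a b, 0 < x t)
    (heq : ∀ t ∈ Set.Ioo a b,
        deriv (deriv x) t + c₂ * x t + k ^ 2 / (x t) ^ 3 = 0) :
    ∀ t ∈ Set.Ioo a b,
      deriv (fun s => deriv x s / x s + k / (x s) ^ 2) t
        + (deriv x t / x t + k / (x t) ^ 2) ^ 2 + c₂ = 0 := by
  intro t ht
  have hne : x t ≠ 0 := (hpos t ht).ne'
  have hd := (hx t ht).hasDerivAt
  have hz := ((hx' t ht).hasDerivAt.fun_div hd hne).fun_add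
    ((hasDerivAt_const t k).fun_div (hd.fun_pow 2) (pow_ne_zero 2 hne))
  have hode : deriv (deriv x) t = -(c₂ * x t) - k ^ 2 / (x t) ^ 3 := by
    linarith [heq t ht]
  rw [hz.deriv, hode]
  field_simp
  ring
end

section
/- Let n be a real constant with n ≠ 0, let f : ℝ → ℝ be twice continuously differentiable, and let x : ℝ → ℝ be three times differentiable and strictly positive on an open interval I satisfying x''' + (1/n)·(3n·f(x) + x·f'(x) + 3n(n−1)·x'/x)·x'' + (n−1)(n−2)·(x')³/x² + (x·(3n·f'(x) + x·f''(x)) + 3n(n−1)·f(x))·(x')²/(n·x) + 3·(n·f(x) + x·f'(x))·f(x)·x'/n + (x/n)·f(x)³ = 0 on I. Then the function z(t) = x'(t)/x(t) + f(x(t))/n satisfies the modified Emden equation z'' + 3n·z·z' + n²·z³ = 0 on I. -/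
/-- If a positive, three times differentiable `x` satisfies the third-order
equation (the expansion of `(d/dt + f(x))³ xⁿ = 0`)
`x''' + (1/n)(3n f(x) + x f'(x) + 3n(n−1)x'/x)x'' + (n−1)(n−2)(x')³/x²
 + (x(3n f'(x) + x f''(x)) + 3n(n−1)f(x))(x')²/(n x) + 3(n f(x) + x f'(x))f(x)x'/n
 + (x/n)f(x)³ = 0`
on an open interval, then `z = x'/x + f(x)/n` satisfies the modified Emden equation
`z'' + 3n z z' + n² z³ = 0` there. -/
theorem stmt_11 (n : ℝ) (hn : n ≠ 0) (f : ℝ → ℝ) (hf : ContDiff ℝ 2 f)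
    (a b : ℝ) (x : ℝ → ℝ)
    (hx : ∀ t ∈ Set.Ioo a b, DifferentiableAt ℝ x t)
    (hx' : ∀ t ∈ Set.Ioo a b, DifferentiableAt ℝ (deriv x) t)
    (hx'' : ∀ t ∈ Set.Ioo a b, DifferentiableAt ℝ (deriv (deriv x)) t)
    (hpos : ∀ t ∈ Set.Ioo a b, 0 < x t)
    (heq : ∀ t ∈ Set.Ioo a b,
        deriv (deriv (deriv x)) t
          + (1 / n) * (3 * n * f (x t) + x t * deriv f (x t)
              + 3 * n * (n - 1) * deriv x t / x t) * deriv (deriv x) t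
          + (n - 1) * (n - 2) * (deriv x t) ^ 3 / (x t) ^ 2
          + (x t * (3 * n * deriv f (x t) + x t * deriv (deriv f) (x t))
              + 3 * n * (n - 1) * f (x t)) * (deriv x t) ^ 2 / (n * x t)
          + 3 * (n * f (x t) + x t * deriv f (x t)) * f (x t) * deriv x t / n
          + (x t / n) * (f (x t)) ^ 3 = 0)
    (z : ℝ → ℝ) (hz : z = fun t => deriv x t / x t + f (x t) / n) :
    ∀ t ∈ Set.Ioo a b,
      deriv (deriv z) t + 3 * n * z t * deriv z t + n ^ 2 * (z t) ^ 3 = 0 := by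
  intro t ht
  have hf₁ (y : ℝ) : HasDerivAt f (deriv f y) y :=
    (hf.differentiable two_ne_zero y).hasDerivAt
  have hf₂ (y : ℝ) : HasDerivAt (deriv f) (deriv (deriv f) y) y := by
    have h : ContDiff ℝ 1 (deriv f) :=
      (contDiff_succ_iff_deriv.mp (by simpa only [one_add_one_eq_two] using hf)).2.2
    exact (h.differentiable one_ne_zero y).hasDerivAt
  have hz₁ : ∀ s ∈ Set.Ioo a b, HasDerivAt z
      ((deriv (deriv x) s * x s - deriv x s * deriv x s) / x s ^ 2
        + deriv f (x s) * deriv x s / n) s := by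
    intro s hs
    rw [hz]
    exact ((hx' s hs).hasDerivAt.div (hx s hs).hasDerivAt (hpos s hs).ne').add
      (((hf₁ (x s)).comp s (hx s hs).hasDerivAt).div_const n)
  have h₁ := (hx t ht).hasDerivAt
  have h₂ := (hx' t ht).hasDerivAt
  have h₃ := (hx'' t ht).hasDerivAt
  have hxt : x t ≠ 0 := (hpos t ht).ne'
  have hz₂ := ((((h₃.mul h₁).sub (h₂.mul h₂)).div (h₁.pow 2) (pow_ne_zero 2 hxt)).add
      ((((hf₂ (x t)).comp t h₁).mul h₂).div_const n)).congr_of_eventuallyEq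
    (f₁ := deriv z) (by
      filter_upwards [isOpen_Ioo.mem_nhds ht] with s hs
      rw [(hz₁ s hs).deriv]
      rfl)
  have h := heq t ht
  rw [hz₂.deriv, (hz₁ t ht).deriv, hz]
  simp only [Pi.mul_apply, Pi.sub_apply, Pi.pow_apply, Function.comp_apply]
  generalize deriv (deriv (deriv x)) t = x₃ at *
  generalize deriv (deriv x) t = x₂ at *
  generalize deriv x t = x₁ at *
  generalize deriv (deriv f) (x t) = f₂ at *
  generalize deriv f (x t) = f₁ at *
  generalize f (x t) = f₀ at *
  generalize x t = x₀ at *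
  refine Eq.trans ?_ (mul_eq_zero_of_right (1 / x₀) h)
  push_cast
  field_simp
  ring
end

section
/- Let n, I₁, I₂ be real constants with n ≠ 0, and let J be an open interval on which Q(t) := I₂ + (n/2)·(I₁+t)² ≠ 0. Then the function z(t) = (I₁ + t)/Q(t) satisfies the modified Emden equation z'' + 3n·z·z' + n²·z³ = 0 on J. -/
/-- On an open interval where `Q(t) = I₂ + (n/2)(I₁+t)² ≠ 0`, the function
`z(t) = (I₁+t)/Q(t)` satisfies the modified Emden equation `z'' + 3n z z' + n² z³ = 0`. -/
theorem stmt_12 (n I₁ I₂ : ℝ) (hn : n ≠ 0) (a b : ℝ)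
    (Q : ℝ → ℝ) (hQ : Q = fun t => I₂ + n / 2 * (I₁ + t) ^ 2)
    (hQne : ∀ t ∈ Set.Ioo a b, Q t ≠ 0)
    (z : ℝ → ℝ) (hz : z = fun t => (I₁ + t) / Q t) :
    ∀ t ∈ Set.Ioo a b,
      deriv (deriv z) t + 3 * n * z t * deriv z t + n ^ 2 * (z t) ^ 3 = 0 := by
  intro t ht
  have hs (s : ℝ) : HasDerivAt (fun u => I₁ + u) 1 s := (hasDerivAt_id s).const_add I₁
  have hQ' (s : ℝ) : HasDerivAt Q (n * (I₁ + s)) s := by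
    rw [hQ]
    refine ((((hs s).pow 2).const_mul (n / 2)).const_add I₂).congr_deriv ?_
    norm_num
    ring
  have hz' (s : ℝ) (h : s ∈ Set.Ioo a b) : HasDerivAt z ((Q s)⁻¹ - n * z s ^ 2) s := by
    have h0 := hQne s h
    rw [hz]
    refine ((hs s).div (hQ' s) h0).congr_deriv ?_
    field_simp
  have h0 := hQne t ht
  have hderiv : deriv z =ᶠ[nhds t] fun s => (Q s)⁻¹ - n * z s ^ 2 := by
    filter_upwards [isOpen_Ioo.mem_nhds ht] with s h using (hz' s h).deriv
  have hz'' := ((hQ' t).fun_inv h0).fun_sub (((hz' t ht).fun_pow 2).const_mul n)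
  rw [hderiv.deriv_eq, hz''.deriv, (hz' t ht).deriv, hz]
  norm_num
  field_simp
  ring
end

section
/- Let k, I₁, I₂, I₃ be real constants, and let J be an open interval on which D(t) := I₁·I₃ + k·I₁·I₂·t + (k·I₁/2)·t² + (k²/6)·t³ ≠ 0. Then the function x(t) = (k·t²/2 + I₁·t + I₁·I₂)/D(t) satisfies the Chazy-type equation x''' + 4k·x·x'' + 3k·(x')² + 6k²·x²·x' + k³·x⁴ = 0 on J. -/
/-- If `f` has derivative `f'` at every point of an open set `s`, then `deriv f` inherits at
`t ∈ s` any derivative of `f'`. -/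
lemma hasDerivAt_deriv_of_isOpen {f f' : ℝ → ℝ} {s : Set ℝ} (hs : IsOpen s)
    (hf : ∀ t ∈ s, HasDerivAt f (f' t) t) {t c : ℝ} (ht : t ∈ s) (hf' : HasDerivAt f' c t) :
    HasDerivAt (deriv f) c t :=
  hf'.congr_of_eventuallyEq <|
    Filter.eventuallyEq_of_mem (hs.mem_nhds ht) fun u hu => (hf u hu).deriv

/-- On an open interval where
`D(t) = I₁I₃ + kI₁I₂t + (kI₁/2)t² + (k²/6)t³ ≠ 0`, the function
`x(t) = (kt²/2 + I₁t + I₁I₂)/D(t)` satisfies the Chazy-type equation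
`x''' + 4kxx'' + 3k(x')² + 6k²x²x' + k³x⁴ = 0`. -/
theorem stmt_13 (k I₁ I₂ I₃ : ℝ) (a b : ℝ)
    (D : ℝ → ℝ)
    (hD : D = fun t => I₁ * I₃ + k * I₁ * I₂ * t + k * I₁ / 2 * t ^ 2 + k ^ 2 / 6 * t ^ 3)
    (hDne : ∀ t ∈ Set.Ioo a b, D t ≠ 0)
    (x : ℝ → ℝ) (hx : x = fun t => (k * t ^ 2 / 2 + I₁ * t + I₁ * I₂) / D t) :
    ∀ t ∈ Set.Ioo a b,
      deriv (deriv (deriv x)) t + 4 * k * x t * deriv (deriv x) t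
        + 3 * k * (deriv x t) ^ 2 + 6 * k ^ 2 * (x t) ^ 2 * deriv x t
        + k ^ 3 * (x t) ^ 4 = 0 := by
  intro t ht
  have hN (u : ℝ) : HasDerivAt (fun t => k * t ^ 2 / 2 + I₁ * t + I₁ * I₂) (k * u + I₁) u := by
    have h := (((((hasDerivAt_id' u).pow 2).const_mul k).div_const 2).add
      ((hasDerivAt_id' u).const_mul I₁)).add_const (I₁ * I₂)
    exact h.congr_deriv (by norm_num; ring)
  have hP (u : ℝ) : HasDerivAt (fun t => k * t + I₁) k u := by
    simpa using ((hasDerivAt_id' u).const_mul k).add_const I₁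
  have hD' (u : ℝ) : HasDerivAt D (k * (k * u ^ 2 / 2 + I₁ * u + I₁ * I₂)) u := by
    rw [hD]
    have h := ((((hasDerivAt_id' u).const_mul (k * I₁ * I₂)).const_add (I₁ * I₃)).add
      (((hasDerivAt_id' u).pow 2).const_mul (k * I₁ / 2))).add
      (((hasDerivAt_id' u).pow 3).const_mul (k ^ 2 / 6))
    exact h.congr_deriv (by norm_num; ring)
  have hxu (u : ℝ) : x u = (k * u ^ 2 / 2 + I₁ * u + I₁ * I₂) / D u := by rw [hx]
  have hq : ∀ u ∈ Set.Ioo a b, HasDerivAt (fun t => (D t)⁻¹) (-(k * x u * (D u)⁻¹)) u := by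
    intro u hu
    refine ((hD' u).fun_inv (hDne u hu)).congr_deriv ?_
    rw [hxu]
    have := hDne u hu
    field_simp
  -- Since `D' = k * N` with `N` the numerator of `x`, we get `x' = N' / D - k * x ^ 2`.
  have h₁ : ∀ u ∈ Set.Ioo a b,
      HasDerivAt x ((k * u + I₁) * (D u)⁻¹ - k * x u ^ 2) u := by
    intro u hu
    have h := (hN u).mul (hq u hu)
    have hxN : x = (fun t => k * t ^ 2 / 2 + I₁ * t + I₁ * I₂) * fun t => (D t)⁻¹ := by
      rw [hx]; ext v; simp [div_eq_mul_inv]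
    rw [← hxN] at h
    refine h.congr_deriv ?_
    rw [hxu]
    ring
  have h₂ : ∀ u ∈ Set.Ioo a b, HasDerivAt (deriv x)
      (k * (D u)⁻¹ - k * x u * ((k * u + I₁) * (D u)⁻¹) - 2 * k * (x u * deriv x u)) u := by
    intro u hu
    refine hasDerivAt_deriv_of_isOpen isOpen_Ioo h₁ hu ?_
    refine (((hP u).mul (hq u hu)).sub (((h₁ u hu).pow 2).const_mul k)).congr_deriv ?_
    rw [(h₁ u hu).deriv]
    norm_num
    ring
  have h₃ := hasDerivAt_deriv_of_isOpen isOpen_Ioo h₂ ht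
    ((((hq t ht).const_mul k).sub
      (((h₁ t ht).const_mul k).mul ((hP t).mul (hq t ht)))).sub
      (((h₁ t ht).mul (h₂ t ht)).const_mul (2 * k)))
  rw [h₃.deriv, (h₂ t ht).deriv, (h₁ t ht).deriv]
  simp only [Pi.mul_apply]
  ring
end

section
/- Let k be a real constant, let x : ℝ → ℝ be three times differentiable on an open interval I, and let F : I → ℝ be differentiable with F'(t) = k·x(t) for all t ∈ I. Define U(t) = x(t)·exp(F(t)). Then x satisfies the Chazy-type equation x''' + 4k·x·x'' + 3k·(x')² + 6k²·x²·x' + k³·x⁴ = 0 on I if and only if U satisfies U''' = 0 on I. -/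
/-- If `F' = c` at `t`, then `(g·exp F)' = (g' + c·g)·exp F` at `t`. -/
theorem HasDerivAt.mul_exp_comp {g F : ℝ → ℝ} {g' c t : ℝ}
    (hg : HasDerivAt g g' t) (hF : HasDerivAt F c t) :
    HasDerivAt (fun s => g s * Real.exp (F s)) ((g' + c * g t) * Real.exp (F t)) t :=
  (hg.mul hF.exp).congr_deriv (by ring)

/-- On an open set, the derivative of a function agreeing with `f` is that of `f`. -/
theorem IsOpen.deriv_eq_of_eqOn {s : Set ℝ} (hs : IsOpen s) {V f f' : ℝ → ℝ}
    (hV : ∀ t ∈ s, V t = f t) (hf : ∀ t ∈ s, HasDerivAt f (f' t) t) :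
    ∀ t ∈ s, deriv V t = f' t := fun t ht =>
  ((hf t ht).congr_of_eventuallyEq
    (Filter.eventually_of_mem (hs.mem_nhds ht) hV)).deriv

/-- With `U(t) = x(t)·exp(F(t))` where `F'(t) = k·x(t)` (the nonlocal
transformation `U = x e^{k∫x dt}`), a three times differentiable `x` satisfies the
Chazy-type equation `x''' + 4kxx'' + 3k(x')² + 6k²x²x' + k³x⁴ = 0` on an open interval
iff `U''' = 0` there. -/
theorem stmt_14 (k : ℝ) (a b : ℝ) (x F : ℝ → ℝ)
    (hx : ∀ t ∈ Set.Ioo a b, DifferentiableAt ℝ x t)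
    (hx' : ∀ t ∈ Set.Ioo a b, DifferentiableAt ℝ (deriv x) t)
    (hx'' : ∀ t ∈ Set.Ioo a b, DifferentiableAt ℝ (deriv (deriv x)) t)
    (hF : ∀ t ∈ Set.Ioo a b, HasDerivAt F (k * x t) t)
    (U : ℝ → ℝ) (hU : U = fun t => x t * Real.exp (F t)) :
    (∀ t ∈ Set.Ioo a b,
        deriv (deriv (deriv x)) t + 4 * k * x t * deriv (deriv x) t
          + 3 * k * (deriv x t) ^ 2 + 6 * k ^ 2 * (x t) ^ 2 * deriv x t
          + k ^ 3 * (x t) ^ 4 = 0) ↔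
    (∀ t ∈ Set.Ioo a b, deriv (deriv (deriv U)) t = 0) := by
  have hs : IsOpen (Set.Ioo a b) := isOpen_Ioo
  have h1 : ∀ t ∈ Set.Ioo a b,
      deriv U t = (deriv x t + k * x t ^ 2) * Real.exp (F t) :=
    hs.deriv_eq_of_eqOn (fun t _ => congrFun hU t) fun t ht =>
      ((hx t ht).hasDerivAt.mul_exp_comp (hF t ht)).congr_deriv (by ring)
  have h2 : ∀ t ∈ Set.Ioo a b,
      deriv (deriv U) t =
        (deriv (deriv x) t + 3 * k * (x t * deriv x t) + k ^ 2 * x t ^ 3) * Real.exp (F t) :=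
    hs.deriv_eq_of_eqOn h1 fun t ht =>
      (((hx' t ht).hasDerivAt.fun_add
        (((hx t ht).hasDerivAt.fun_pow 2).const_mul k)).mul_exp_comp (hF t ht)).congr_deriv
        (by push_cast; ring)
  have h3 : ∀ t ∈ Set.Ioo a b,
      deriv (deriv (deriv U)) t =
        (deriv (deriv (deriv x)) t + 4 * k * x t * deriv (deriv x) t
          + 3 * k * (deriv x t) ^ 2 + 6 * k ^ 2 * (x t) ^ 2 * deriv x t
          + k ^ 3 * (x t) ^ 4) * Real.exp (F t) :=
    hs.deriv_eq_of_eqOn h2 fun t ht =>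
      ((((hx'' t ht).hasDerivAt.fun_add
        (((hx t ht).hasDerivAt.fun_mul (hx' t ht).hasDerivAt).const_mul (3 * k))).fun_add
        (((hx t ht).hasDerivAt.fun_pow 3).const_mul (k ^ 2))).mul_exp_comp (hF t ht)).congr_deriv
        (by push_cast; ring)
  refine forall₂_congr fun t ht => ?_
  rw [h3 t ht, mul_eq_zero, or_iff_left (Real.exp_ne_zero _)]
end

section
/- Let U : ℝ → ℝ be infinitely differentiable and nonvanishing on an open interval I, and set X(t) = U'(t)/U(t). Define the operator D_X by (D_X h)(t) = h'(t) + X(t)·h(t). Then for every natural number k and every t ∈ I, (D_X^[k] X)(t) = U^{(k+1)}(t)/U(t), where D_X^[k] is the k-fold iterate of D_X and U^{(k+1)} is the (k+1)-th derivative of U. In particular, if U^{(m)} = 0 on I for some m ≥ 1, then X satisfies the Riccati-chain equation (D_X^[m−1] X) = 0 on I. -/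
/-- The first-order operator `D_a = d/dt + a`, i.e. `(D_a h)(t) = h'(t) + a(t)h(t)`. -/
noncomputable def Dop (a h : ℝ → ℝ) : ℝ → ℝ := fun t => deriv h t + a t * h t

theorem ContDiffOn.iterate_deriv_of_isOpen {f : ℝ → ℝ} {s : Set ℝ}
    (hf : ContDiffOn ℝ (⊤ : ℕ∞) f s) (hs : IsOpen s) (k : ℕ) :
    ContDiffOn ℝ (⊤ : ℕ∞) (deriv^[k] f) s := by
  induction k with
  | zero => exact hf
  | succ k ih =>
    rw [Function.iterate_succ_apply']
    exact ih.deriv_of_isOpen hs (by simp)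

/-- Iterating `D_X` on `X = U'/U` yields the quotients `U⁽ᵏ⁺¹⁾/U`. -/
theorem Dop_iterate_logDeriv {U : ℝ → ℝ} {s : Set ℝ} (hs : IsOpen s)
    (hU : ContDiffOn ℝ (⊤ : ℕ∞) U s) (hUne : ∀ t ∈ s, U t ≠ 0) (k : ℕ) :
    ∀ t ∈ s, (Dop fun t => deriv U t / U t)^[k] (fun t => deriv U t / U t) t =
      deriv^[k + 1] U t / U t := by
  induction k with
  | zero => intro t _; rfl
  | succ k ih =>
    intro t ht
    have hnhds : s ∈ nhds t := hs.mem_nhds ht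
    have hdiff (j : ℕ) : DifferentiableAt ℝ (deriv^[j] U) t :=
      ((hU.iterate_deriv_of_isOpen hs j).contDiffAt hnhds).differentiableAt (by simp)
    have heq : (Dop fun t => deriv U t / U t)^[k] (fun t => deriv U t / U t) =ᶠ[nhds t]
        fun t => deriv^[k + 1] U t / U t := Filter.eventually_of_mem hnhds ih
    have hdiffU : DifferentiableAt ℝ U t := hdiff 0
    have hne := hUne t ht
    rw [Function.iterate_succ_apply', Dop, heq.deriv_eq, ih t ht,
      deriv_fun_div (hdiff (k + 1)) hdiffU hne, Function.iterate_succ_apply' deriv (k + 1)]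
    field_simp
    ring

/-- For smooth nonvanishing `U` on an open interval and `X = U'/U`, one has
`(D_X^[k] X)(t) = U^{(k+1)}(t)/U(t)` for every `k`; in particular, if `U⁽ᵐ⁾ = 0` on the
interval for some `m ≥ 1`, then `X` satisfies the Riccati-chain equation
`D_X^[m−1] X = 0` there. -/
theorem stmt_16 (a b : ℝ) (U : ℝ → ℝ)
    (hU : ContDiffOn ℝ (⊤ : ℕ∞) U (Set.Ioo a b))
    (hUne : ∀ t ∈ Set.Ioo a b, U t ≠ 0)
    (X : ℝ → ℝ) (hX : X = fun t => deriv U t / U t) :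
    (∀ (k : ℕ), ∀ t ∈ Set.Ioo a b, (Dop X)^[k] X t = deriv^[k + 1] U t / U t) ∧
    (∀ m : ℕ, 1 ≤ m → (∀ t ∈ Set.Ioo a b, deriv^[m] U t = 0) →
      ∀ t ∈ Set.Ioo a b, (Dop X)^[m - 1] X t = 0) := by
  subst hX
  have key := Dop_iterate_logDeriv isOpen_Ioo hU hUne
  refine ⟨key, fun m hm h t ht => ?_⟩
  rw [key (m - 1) t ht, Nat.sub_add_cancel hm, h t ht, zero_div]
end

section
/- Let n be a real constant with n ≠ 0, let m ≥ 1 be a natural number, let f : ℝ → ℝ be infinitely differentiable, and let x : ℝ → ℝ be infinitely differentiable and strictly positive on an open interval I. Set g(t) = x(t)^n and let D denote the operator (D h)(t) = h'(t) + f(x(t))·h(t). Suppose (D^[m] g)(t) = 0 for all t ∈ I. Then the function z(t) = x'(t)/x(t) + f(x(t))/n satisfies (E^[m−1] z)(t) = 0 for all t ∈ I, where E is the operator (E h)(t) = h'(t) + n·z(t)·h(t). -/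
/-- `D_a` preserves smoothness on open sets. -/
theorem ContDiffOn.dop {a h : ℝ → ℝ} {s : Set ℝ} (hs : IsOpen s)
    (ha : ContDiffOn ℝ (⊤ : ℕ∞) a s) (hh : ContDiffOn ℝ (⊤ : ℕ∞) h s) :
    ContDiffOn ℝ (⊤ : ℕ∞) (Dop a h) s :=
  (hh.deriv_of_isOpen hs (by simp)).add (ha.mul hh)

/-- If `D_a w = b w` on an open set, multiplication by `w` intertwines `D_b` and `D_a` there,
together with all their iterates. -/
theorem iterate_dop_eqOn_mul {a b w : ℝ → ℝ} {s : Set ℝ} (hs : IsOpen s)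
    (hb : ContDiffOn ℝ (⊤ : ℕ∞) b s) (hw : DifferentiableOn ℝ w s)
    (hab : ∀ t ∈ s, Dop a w t = b t * w t) (k : ℕ) :
    ∀ {h u : ℝ → ℝ}, ContDiffOn ℝ (⊤ : ℕ∞) h s → s.EqOn u (fun t => w t * h t) →
      s.EqOn ((Dop a)^[k] u) (fun t => w t * (Dop b)^[k] h t) := by
  induction k with
  | zero => exact fun _ hu => hu
  | succ k ih =>
    intro h u hh hu
    simp only [Function.iterate_succ_apply]
    refine ih (ContDiffOn.dop hs hb hh) fun t ht => ?_
    have hmem := hs.mem_nhds ht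
    have hwt := (hw.differentiableAt hmem).hasDerivAt
    have hht := ((hh.differentiableOn (by simp)).differentiableAt hmem).hasDerivAt
    have hderiv : deriv u t = deriv w t * h t + w t * deriv h t :=
      (hu.eventuallyEq_of_mem hmem).deriv_eq.trans (hwt.mul hht).deriv
    have habt := hab t ht
    simp only [Dop] at habt ⊢
    rw [hderiv, hu ht]
    linear_combination h t * habt

/-- Let `g = xⁿ` (real power of the positive `x`) and `D = d/dt + f(x)`.
If `(Dᵐ g) = 0` on an open interval (the `m`-th order generalization of the Riccati and
Abel chains, `(d/dt + f(x))ᵐ xⁿ = 0`), then `z = x'/x + f(x)/n` satisfies the Riccati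
chain equation `(d/dt + nz)^{m−1} z = 0` there. -/
theorem stmt_17 (n : ℝ) (hn : n ≠ 0) (m : ℕ) (hm : 1 ≤ m)
    (f : ℝ → ℝ) (hf : ContDiff ℝ (⊤ : ℕ∞) f)
    (a b : ℝ) (x : ℝ → ℝ)
    (hx : ContDiffOn ℝ (⊤ : ℕ∞) x (Set.Ioo a b))
    (hpos : ∀ t ∈ Set.Ioo a b, 0 < x t)
    (g : ℝ → ℝ) (hg : g = fun t => x t ^ n)
    (z : ℝ → ℝ) (hz : z = fun t => deriv x t / x t + f (x t) / n)
    (heq : ∀ t ∈ Set.Ioo a b, (Dop (fun s => f (x s)))^[m] g t = 0) :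
    ∀ t ∈ Set.Ioo a b, (Dop (fun s => n * z s))^[m - 1] z t = 0 := by
  obtain ⟨k, rfl⟩ := Nat.exists_eq_add_of_le' hm
  have hs : IsOpen (Set.Ioo a b) := isOpen_Ioo
  have hxd : ∀ t ∈ Set.Ioo a b, HasDerivAt x (deriv x t) t := fun t ht =>
    ((hx.differentiableOn (by simp)).differentiableAt (hs.mem_nhds ht)).hasDerivAt
  have hzs : ContDiffOn ℝ (⊤ : ℕ∞) z (Set.Ioo a b) := by
    rw [hz]
    exact ((hx.deriv_of_isOpen hs (by simp)).div hx fun t ht => (hpos t ht).ne').add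
      ((hf.comp_contDiffOn hx).div_const n)
  have hgd : ∀ t ∈ Set.Ioo a b, HasDerivAt g (n * g t * (deriv x t / x t)) t := by
    intro t ht
    have hxt := hpos t ht
    rw [hg]
    convert (hxd t ht).rpow_const (p := n) (Or.inl hxt.ne') using 1
    rw [Real.rpow_sub_one hxt.ne']
    ring
  have hDg : ∀ t ∈ Set.Ioo a b, Dop (fun s => f (x s)) g t = n * g t * z t := by
    intro t ht
    simp only [Dop, (hgd t ht).deriv, hz]
    field_simp
  have hwd : ∀ t ∈ Set.Ioo a b, HasDerivAt (fun t => n * g t)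
      (n * (n * g t * (deriv x t / x t))) t := fun t ht => (hgd t ht).const_mul n
  have hDw : ∀ t ∈ Set.Ioo a b,
      Dop (fun s => f (x s)) (fun t => n * g t) t = n * z t * (n * g t) := by
    intro t ht
    have h := hDg t ht
    simp only [Dop, (hgd t ht).deriv] at h
    simp only [Dop, (hwd t ht).deriv]
    linear_combination n * h
  intro t ht
  have h := iterate_dop_eqOn_mul hs ((contDiffOn_const (c := n)).mul hzs)
    (fun t ht => (hwd t ht).differentiableAt.differentiableWithinAt) hDw k hzs hDg ht
  rw [← Function.iterate_succ_apply, heq t ht] at h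
  have hgt : g t ≠ 0 := by
    rw [hg]
    exact (Real.rpow_pos_of_pos (hpos t ht) n).ne'
  exact (mul_eq_zero.mp h.symm).resolve_left (mul_ne_zero hn hgt)
end

section
/- Let n be a real constant with n ≠ 0, let x, y : ℝ → ℝ be twice differentiable and strictly positive on an open interval I, and let φ : I → ℝ be a differentiable function (playing the role of t ↦ f(x(t), y(t)) for a common coupling function f = g). Suppose that on I both equations hold: x'' + (n−1)·(x')²/x + 2·x'·φ + (x/n)·φ' + (x/n)·φ² = 0 and y'' + (n−1)·(y')²/y + 2·y'·φ + (y/n)·φ' + (y/n)·φ² = 0. Then the functions z₁(t) = x'(t)/x(t) + φ(t)/n and z₂(t) = y'(t)/y(t) + φ(t)/n satisfy the Riccati equations z₁' = −n·z₁² and z₂' = −n·z₂² on I. -/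
theorem deriv_logDeriv_add_div_eq_neg_mul_sq {n : ℝ} (hn : n ≠ 0) {x φ : ℝ → ℝ} {t : ℝ}
    (hx : DifferentiableAt ℝ x t) (hx' : DifferentiableAt ℝ (deriv x) t) (hx0 : x t ≠ 0)
    (hφ : DifferentiableAt ℝ φ t)
    (heq : deriv (deriv x) t + (n - 1) * (deriv x t) ^ 2 / x t + 2 * deriv x t * φ t
      + (x t / n) * deriv φ t + (x t / n) * (φ t) ^ 2 = 0) :
    deriv (fun s => deriv x s / x s + φ s / n) t = -n * (deriv x t / x t + φ t / n) ^ 2 := by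
  have hz : HasDerivAt (fun s => deriv x s / x s + φ s / n) _ t :=
    (hx'.hasDerivAt.div hx.hasDerivAt hx0).add (hφ.hasDerivAt.div_const n)
  rw [hz.deriv]
  field_simp at heq ⊢
  linear_combination heq

/-- If positive twice differentiable `x, y` satisfy the coupled system
`x'' + (n−1)(x')²/x + 2x'φ + (x/n)φ' + (x/n)φ² = 0`,
`y'' + (n−1)(y')²/y + 2y'φ + (y/n)φ' + (y/n)φ² = 0`
on an open interval (with `φ` differentiable, playing the role of `t ↦ f(x(t),y(t))` for
a common coupling `f = g`), then `z₁ = x'/x + φ/n` and `z₂ = y'/y + φ/n` satisfy the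
Riccati equations `z₁' = −n z₁²` and `z₂' = −n z₂²` there. -/
theorem stmt_18 (n : ℝ) (hn : n ≠ 0) (a b : ℝ) (x y φ : ℝ → ℝ)
    (hx : ∀ t ∈ Set.Ioo a b, DifferentiableAt ℝ x t)
    (hx' : ∀ t ∈ Set.Ioo a b, DifferentiableAt ℝ (deriv x) t)
    (hy : ∀ t ∈ Set.Ioo a b, DifferentiableAt ℝ y t)
    (hy' : ∀ t ∈ Set.Ioo a b, DifferentiableAt ℝ (deriv y) t)
    (hxpos : ∀ t ∈ Set.Ioo a b, 0 < x t)
    (hypos : ∀ t ∈ Set.Ioo a b, 0 < y t)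
    (hφ : ∀ t ∈ Set.Ioo a b, DifferentiableAt ℝ φ t)
    (heqx : ∀ t ∈ Set.Ioo a b,
        deriv (deriv x) t + (n - 1) * (deriv x t) ^ 2 / x t + 2 * deriv x t * φ t
          + (x t / n) * deriv φ t + (x t / n) * (φ t) ^ 2 = 0)
    (heqy : ∀ t ∈ Set.Ioo a b,
        deriv (deriv y) t + (n - 1) * (deriv y t) ^ 2 / y t + 2 * deriv y t * φ t
          + (y t / n) * deriv φ t + (y t / n) * (φ t) ^ 2 = 0)
    (z₁ z₂ : ℝ → ℝ)
    (hz₁ : z₁ = fun t => deriv x t / x t + φ t / n)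
    (hz₂ : z₂ = fun t => deriv y t / y t + φ t / n) :
    ∀ t ∈ Set.Ioo a b,
      deriv z₁ t = -n * (z₁ t) ^ 2 ∧ deriv z₂ t = -n * (z₂ t) ^ 2 := by
  subst hz₁ hz₂
  intro t ht
  exact ⟨deriv_logDeriv_add_div_eq_neg_mul_sq hn (hx t ht) (hx' t ht) (hxpos t ht).ne'
      (hφ t ht) (heqx t ht),
    deriv_logDeriv_add_div_eq_neg_mul_sq hn (hy t ht) (hy' t ht) (hypos t ht).ne'
      (hφ t ht) (heqy t ht)⟩
end
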